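/- Let (A, G) be any of the pairs defining a quantum Kleinian singularity: (i) A = k_q[u,v] with G cyclic of order n acting by g·u = ωu, g·v = ω^{−1}v for ω a primitive nth root of unity; (ii) A = k_{−1}[u,v] with G = S_2 acting by h·u = v, h·v = u; (iii) A = k_{−1}[u,v] with G = D_n the dihedral group of order 2n acting by g·u = ωu, g·v = ω^{−1}v, h·u = v, h·v = u; (iv) A = k_J[u,v] with G = C_2 acting by u ↦ −u, v ↦ −v. Then Auslander's Theorem holds: the endomorphism ring of A as a right module over its invariant ring A^G is isomorphic to the skew group ring, End_{A^G}(A) ≅ A # G. -/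

import Mathlib

/-- The relation defining the quantum plane `K_q[u,v]`: `v u = q · u v`. -/
inductive QuantumRel (K : Type*) [CommRing K] (q : K) :
    FreeAlgebra K (Fin 2) → FreeAlgebra K (Fin 2) → Prop
  | rel : QuantumRel K q (FreeAlgebra.ι K 1 * FreeAlgebra.ι K 0)
      (q • (FreeAlgebra.ι K 0 * FreeAlgebra.ι K 1))

/-- The quantum plane `K_q[u,v] = K⟨u,v⟩/(vu - q·uv)`. -/
abbrev QuantumPlane (K : Type*) [CommRing K] (q : K) := RingQuot (QuantumRel K q)

/-- The generator `u` of the quantum plane. -/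
noncomputable def qU (K : Type*) [CommRing K] (q : K) : QuantumPlane K q :=
  RingQuot.mkAlgHom K (QuantumRel K q) (FreeAlgebra.ι K 0)

/-- The generator `v` of the quantum plane. -/
noncomputable def qV (K : Type*) [CommRing K] (q : K) : QuantumPlane K q :=
  RingQuot.mkAlgHom K (QuantumRel K q) (FreeAlgebra.ι K 1)

/-- The relation defining the Jordan plane `K_J[u,v]`: `v u = u v + u²`. -/
inductive JordanRel (K : Type*) [CommRing K] :
    FreeAlgebra K (Fin 2) → FreeAlgebra K (Fin 2) → Prop
  | rel : JordanRel K (FreeAlgebra.ι K 1 * FreeAlgebra.ι K 0)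
      (FreeAlgebra.ι K 0 * FreeAlgebra.ι K 1 + FreeAlgebra.ι K 0 * FreeAlgebra.ι K 0)

/-- The Jordan plane `K_J[u,v] = K⟨u,v⟩/(vu - uv - u²)`. -/
abbrev JordanPlane (K : Type*) [CommRing K] := RingQuot (JordanRel K)

/-- The generator `u` of the Jordan plane. -/
noncomputable def jU (K : Type*) [CommRing K] : JordanPlane K :=
  RingQuot.mkAlgHom K (JordanRel K) (FreeAlgebra.ι K 0)

/-- The generator `v` of the Jordan plane. -/
noncomputable def jV (K : Type*) [CommRing K] : JordanPlane K :=
  RingQuot.mkAlgHom K (JordanRel K) (FreeAlgebra.ι K 1)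

section General

variable {A G : Type*} [Ring A] [Group G] [MulSemiringAction G A]

/-- The functions `g ↦ ∑ aⱼ * (g • bⱼ)`, that is, the coefficient functions of the elements of the
two-sided ideal of `A # G` generated by `∑ g`. -/
def traceIdeal (G A : Type*) [Ring A] [Group G] [MulSemiringAction G A] :
    AddSubgroup (G → A) :=
  AddSubgroup.closure {F | ∃ a b : A, F = fun g => a * g • b}

theorem mem_traceIdeal (a b : A) : (fun g : G => a * g • b) ∈ traceIdeal G A :=
  AddSubgroup.subset_closure ⟨a, b, rfl⟩

theorem mul_mem_traceIdeal (p q : A) {F : G → A} (hF : F ∈ traceIdeal G A) :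
    (fun g => p * F g * g • q) ∈ traceIdeal G A := by
  induction hF using AddSubgroup.closure_induction with
  | mem F h =>
    obtain ⟨a, b, rfl⟩ := h
    simpa [mul_assoc] using mem_traceIdeal (G := G) (p * a) (b * q)
  | zero =>
    convert (traceIdeal G A).zero_mem using 1
    ext g
    simp
  | add F₁ F₂ _ _ h₁ h₂ =>
    convert add_mem h₁ h₂ using 1
    ext g
    simp [mul_add, add_mul]
  | neg F _ h =>
    convert neg_mem h using 1
    ext g
    simp

theorem conj_mem_traceIdeal (h : G) {F : G → A} (hF : F ∈ traceIdeal G A) :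
    (fun g => h • F (h⁻¹ * g * h)) ∈ traceIdeal G A := by
  induction hF using AddSubgroup.closure_induction with
  | mem F hF =>
    obtain ⟨a, b, rfl⟩ := hF
    convert mem_traceIdeal (G := G) (h • a) (h • b) using 2 with g
    simp [smul_smul, mul_assoc]
  | zero =>
    convert (traceIdeal G A).zero_mem using 1
    ext g
    simp
  | add F₁ F₂ _ _ h₁ h₂ =>
    convert add_mem h₁ h₂ using 1
    ext g
    simp
  | neg F _ h =>
    convert neg_mem h using 1
    ext g
    simp

open Classical in
/-- The intersection of `A` with the two-sided ideal of `A # G` generated by `∑ g`. -/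
noncomputable def pertinencyIdeal (G A : Type*) [Ring A] [Group G] [MulSemiringAction G A] :
    AddSubgroup A :=
  (traceIdeal G A).comap (AddMonoidHom.single (fun _ : G => A) 1)

open Classical in
theorem mem_pertinencyIdeal {x : A} :
    x ∈ pertinencyIdeal G A ↔ (Pi.single 1 x : G → A) ∈ traceIdeal G A := Iff.rfl

theorem mem_pertinencyIdeal_of_forall {F : G → A} (hF : F ∈ traceIdeal G A)
    (h : ∀ g, g ≠ 1 → F g = 0) : F 1 ∈ pertinencyIdeal G A := by
  classical
  rw [mem_pertinencyIdeal]
  convert hF using 1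
  ext g
  by_cases hg : g = 1
  · subst hg; simp
  · simp [hg, h g hg]

theorem mul_mul_mem_pertinencyIdeal (p q : A) {x : A} (hx : x ∈ pertinencyIdeal G A) :
    p * x * q ∈ pertinencyIdeal G A := by
  classical
  have := mem_pertinencyIdeal_of_forall (mul_mem_traceIdeal p q (mem_pertinencyIdeal.1 hx))
    (fun g hg => by simp [hg])
  simpa using this

theorem mul_mem_pertinencyIdeal (p : A) {x : A} (hx : x ∈ pertinencyIdeal G A) :
    p * x ∈ pertinencyIdeal G A := by
  simpa using mul_mul_mem_pertinencyIdeal p 1 hx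

theorem smul_mem_pertinencyIdeal {x : A} (h : G) (hx : x ∈ pertinencyIdeal G A) :
    h • x ∈ pertinencyIdeal G A := by
  classical
  have := mem_pertinencyIdeal_of_forall (conj_mem_traceIdeal h (mem_pertinencyIdeal.1 hx))
    (fun g hg => by
      have : h⁻¹ * g * h ≠ 1 := fun e => hg (by
        have := congrArg (fun t => h * t * h⁻¹) e
        simpa [mul_assoc] using this)
      simp [this])
  simpa using this

variable [Fintype G]

theorem eq_zero_of_sum_mul_smul_eq_zero {x : A} (hx : x ∈ pertinencyIdeal G A)
    (hreg : ∀ c, c * x = 0 → c = 0) (c : G → A) (hc : ∀ z : A, ∑ g, c g * g • z = 0) (g : G) :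
    c g = 0 := by
  classical
  have key : ∀ F ∈ traceIdeal G A, ∀ k : G, ∑ g, c g * g • F (g⁻¹ * k) = 0 := by
    intro F hF k
    induction hF using AddSubgroup.closure_induction with
    | mem F hF =>
      obtain ⟨a, b, rfl⟩ := hF
      simp [smul_smul, ← mul_assoc, ← Finset.sum_mul, hc]
    | zero => simp
    | add F₁ F₂ _ _ h₁ h₂ => simp [mul_add, Finset.sum_add_distrib, h₁, h₂]
    | neg F _ h => simp [h]
  have h1 := key _ (mem_pertinencyIdeal.1 hx) g
  rw [Finset.sum_eq_single g (fun b _ hb => by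
    have : b⁻¹ * g ≠ 1 := fun e => hb (inv_mul_eq_one.1 e)
    simp [this]) (by simp)] at h1
  have h2 : (g⁻¹ • c g) * x = 0 := by
    have := congrArg (g⁻¹ • ·) h1
    simpa [smul_smul] using this
  exact (smul_eq_zero_iff_eq g⁻¹).1 (hreg _ h2)

theorem exists_sum_mul_smul_of_mem_pertinencyIdeal (φ : A →+ A)
    (hφ : ∀ x s : A, (∀ g : G, g • s = s) → φ (x * s) = φ x * s)
    {x : A} (hx : x ∈ pertinencyIdeal G A) :
    ∃ c : G → A, ∀ z, φ (x * z) = ∑ g, c g * g • z := by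
  classical
  have key : ∀ F ∈ traceIdeal G A, ∃ c : G → A, ∀ z, φ (∑ g, F g * g • z) = ∑ g, c g * g • z := by
    intro F hF
    induction hF using AddSubgroup.closure_induction with
    | mem F hF =>
      obtain ⟨a, b, rfl⟩ := hF
      refine ⟨fun g => φ a * g • b, fun z => ?_⟩
      have : ∀ d : A, ∑ g : G, d * g • b * g • z = d * ∑ g : G, g • (b * z) := fun d => by
        simp [Finset.mul_sum, mul_assoc]
      rw [this, this]
      refine hφ _ _ fun h => ?_
      rw [Finset.smul_sum]
      simp only [smul_smul]
      exact (Group.mulLeft_bijective h).sum_comp (fun g => g • (b * z))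
    | zero => exact ⟨0, by simp⟩
    | add F₁ F₂ _ _ h₁ h₂ =>
      obtain ⟨c₁, h₁⟩ := h₁
      obtain ⟨c₂, h₂⟩ := h₂
      exact ⟨c₁ + c₂, fun z => by simp [add_mul, Finset.sum_add_distrib, h₁, h₂]⟩
    | neg F _ h =>
      obtain ⟨c, h⟩ := h
      exact ⟨-c, fun z => by simp [h]⟩
  obtain ⟨c, hc⟩ := key _ (mem_pertinencyIdeal.1 hx)
  refine ⟨c, fun z => ?_⟩
  rw [← hc, Finset.sum_eq_single 1 (fun b _ hb => by simp [hb]) (by simp)]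
  simp

/-- A criterion for Auslander's theorem: `x` and `y` lie in the pertinency ideal and behave like a
regular sequence. -/
theorem auslander_of_mem_pertinencyIdeal (x y y' s : A)
    (hx : x ∈ pertinencyIdeal G A) (hy : y ∈ pertinencyIdeal G A) (hxy : y * x = x * y')
    (hreg : ∀ c, c * x = 0 → c = 0)
    (hdvd : ∀ f b, f * y' = b * x → ∃ p, f = p * x)
    (hs : ∀ g : G, g • s = s) (hsreg : ∀ c, c * s = 0 → c = 0)
    (hsx : ∀ z, ∃ w, z * s = x * w) :
    (∀ φ : A →+ A, (∀ x s : A, (∀ g : G, g • s = s) → φ (x * s) = φ x * s) →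
        ∃ c : G → A, ∀ x : A, φ x = ∑ g : G, c g * (g • x)) ∧
      (∀ c : G → A, (∀ x : A, (∑ g : G, c g * (g • x)) = 0) → ∀ g : G, c g = 0) := by
  have hfaith := eq_zero_of_sum_mul_smul_eq_zero hx hreg
  refine ⟨fun φ hφ => ?_, hfaith⟩
  obtain ⟨F, hF⟩ := exists_sum_mul_smul_of_mem_pertinencyIdeal φ hφ hx
  obtain ⟨H, hH⟩ := exists_sum_mul_smul_of_mem_pertinencyIdeal φ hφ hy
  have hFH : ∀ g, F g * g • y' - H g * g • x = 0 := by
    refine hfaith _ fun z => ?_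
    have h1 := hF (y' * z)
    rw [← mul_assoc, ← hxy, mul_assoc, hH] at h1
    simp only [smul_mul', ← mul_assoc] at h1
    simp [sub_mul, h1]
  have hP : ∀ g, ∃ p, F g = p * g • x := by
    intro g
    have h1 : (g⁻¹ • F g) * y' = (g⁻¹ • H g) * x := by
      have := congrArg (g⁻¹ • ·) (sub_eq_zero.1 (hFH g))
      simpa [smul_smul] using this
    obtain ⟨p, hp⟩ := hdvd _ _ h1
    refine ⟨g • p, ?_⟩
    rw [← smul_mul', ← hp, smul_inv_smul]
  choose P hP using hP
  refine ⟨P, fun z => sub_eq_zero.1 (hsreg _ ?_)⟩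
  obtain ⟨w, hw⟩ := hsx z
  rw [sub_mul, ← hφ _ _ hs, hw, hF, Finset.sum_mul, ← Finset.sum_sub_distrib]
  refine Finset.sum_eq_zero fun g _ => ?_
  rw [hP, mul_assoc, mul_assoc, ← smul_mul', ← hw, smul_mul', hs, sub_self]

end General

section Regularity

variable {k A : Type*} [Field k] [Ring A] [Algebra k A]

open Polynomial

/-- Left multiplication by `v` on the model `⨁ⱼ k[u] vʲ` of an Ore extension of `k[u]`. -/
noncomputable def oreMulLeft (τ δ : k[X] →ₗ[k] k[X]) : Module.End k (ℕ →₀ k[X]) :=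
  Finsupp.lmapDomain k[X] k Nat.succ ∘ₗ Finsupp.mapRange.linearMap τ +
    Finsupp.mapRange.linearMap δ

theorem oreMulLeft_single (τ δ : k[X] →ₗ[k] k[X]) (i : ℕ) (p : k[X]) :
    oreMulLeft τ δ (Finsupp.single i p) =
      Finsupp.single (i + 1) (τ p) + Finsupp.single i (δ p) := by
  simp [oreMulLeft]

/-- Left multiplication by `u` on the model `⨁ⱼ k[u] vʲ` of an Ore extension of `k[u]`. -/
noncomputable def coeffMulX (k : Type*) [Field k] : Module.End k (ℕ →₀ k[X]) :=
  Finsupp.mapRange.linearMap (LinearMap.mulLeft k X)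

theorem coeffMulX_single (i : ℕ) (p : k[X]) :
    coeffMulX k (Finsupp.single i p) = Finsupp.single i (X * p) := by
  simp [coeffMulX]

theorem eq_zero_of_mul_left_eq_zero (u v : A) (hgen : Algebra.adjoin k {u, v} = ⊤)
    (τ δ : k[X] →ₗ[k] k[X])
    (hv : ∀ p, v * aeval u p = aeval u (τ p) * v + aeval u (δ p))
    (ρ : A →ₐ[k] Module.End k (ℕ →₀ k[X])) (hρu : ρ u = coeffMulX k)
    (hρv : ρ v = oreMulLeft τ δ) (a : A) (ha : u * a = 0) : a = 0 := by
  let η : (ℕ →₀ k[X]) →ₗ[k] A :=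
    Finsupp.lsum k fun i => LinearMap.mulRight k (v ^ i) ∘ₗ (aeval u).toLinearMap
  have hη : ∀ i p, η (Finsupp.single i p) = aeval u p * v ^ i := fun i p => by simp [η]
  have hmul : ∀ a m, η (ρ a m) = a * η m := by
    intro a
    have ha : a ∈ Algebra.adjoin k {u, v} := hgen ▸ Algebra.mem_top
    induction ha using Algebra.adjoin_induction with
    | mem x hx =>
      intro m
      induction m using Finsupp.induction_linear with
      | zero => simp
      | add m₁ m₂ h₁ h₂ => simp [mul_add, h₁, h₂]
      | single i p =>
        rcases hx with rfl | rfl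
        · rw [hρu, coeffMulX_single, hη, hη, map_mul, aeval_X, mul_assoc]
        · rw [hρv, oreMulLeft_single, map_add, hη, hη, hη, ← mul_assoc, hv, add_mul, mul_assoc,
            pow_succ']
    | algebraMap r => intro m; simp [Algebra.smul_def]
    | add x y _ _ hx hy => intro m; simp [hx, hy, add_mul]
    | mul x y _ _ hx hy => intro m; simp [hx, hy, mul_assoc]
  have h1 : ρ a (Finsupp.single 0 1) = 0 := by
    have h2 : coeffMulX k (ρ a (Finsupp.single 0 1)) = 0 := by
      rw [← hρu, ← Module.End.mul_apply, ← map_mul, ha]; simp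
    ext1 i
    have := DFunLike.congr_fun h2 i
    simpa [coeffMulX] using this
  have := hmul a (Finsupp.single 0 1)
  rw [h1, hη] at this
  simpa using this.symm

theorem eq_zero_of_mul_right_eq_zero (u v : A) (hgen : Algebra.adjoin k {u, v} = ⊤)
    (hu : ∀ a, u * a = 0 → a = 0) (σ τ : A →ₐ[k] A) (hσu : u * σ u = u * u)
    (hσv : v * u = u * σ v) (hτu : τ (σ u) = u) (hτv : τ (σ v) = v)
    (hστu : σ (τ u) = u) (hστv : σ (τ v) = v) :
    (∀ z, z * u = u * σ z) ∧ (∀ z, u * z = τ z * u) ∧ ∀ c, c * u = 0 → c = 0 := by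
  have h1 : ∀ z, z * u = u * σ z := by
    intro z
    have hz : z ∈ Algebra.adjoin k {u, v} := hgen ▸ Algebra.mem_top
    induction hz using Algebra.adjoin_induction with
    | mem x hx =>
      rcases hx with rfl | rfl
      · exact hσu.symm
      · exact hσv
    | algebraMap r => simp [Algebra.commutes]
    | add x y _ _ hx hy => simp [hx, hy, add_mul, mul_add]
    | mul x y _ _ hx hy => rw [mul_assoc, hy, ← mul_assoc, hx, mul_assoc, map_mul]
  have h2 : τ.comp σ = AlgHom.id k A := by
    refine AlgHom.ext_of_adjoin_eq_top hgen ?_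
    rintro x (rfl | rfl)
    · exact hτu
    · exact hτv
  have h3 : σ.comp τ = AlgHom.id k A := by
    refine AlgHom.ext_of_adjoin_eq_top hgen ?_
    rintro x (rfl | rfl)
    · exact hστu
    · exact hστv
  refine ⟨h1, fun z => ?_, fun c hc => ?_⟩
  · rw [h1]
    exact congrArg (u * ·) (DFunLike.congr_fun h3 z).symm
  have h4 := hu _ ((h1 c).symm.trans hc)
  have := DFunLike.congr_fun h2 c
  simpa [h4] using this.symm

theorem exists_eq_mul_add_aeval (u v : A) (hgen : Algebra.adjoin k {u, v} = ⊤)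
    (hu : ∀ z, ∃ w, u * z = w * u) (f : A) : ∃ (a : A) (p : k[X]), f = a * u + aeval v p := by
  have hf : f ∈ Algebra.adjoin k {u, v} := hgen ▸ Algebra.mem_top
  induction hf using Algebra.adjoin_induction with
  | mem x hx =>
    rcases hx with rfl | rfl
    · exact ⟨1, 0, by simp⟩
    · exact ⟨0, X, by simp⟩
  | algebraMap r => exact ⟨0, C r, by simp⟩
  | add x y _ _ hx hy =>
    obtain ⟨a, p, rfl⟩ := hx
    obtain ⟨b, r, rfl⟩ := hy
    exact ⟨a + b, p + r, by simp [add_mul]; abel⟩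
  | mul x y _ _ hx hy =>
    obtain ⟨a, p, rfl⟩ := hx
    obtain ⟨b, r, rfl⟩ := hy
    obtain ⟨w, hw⟩ := hu (b * u + aeval v r)
    refine ⟨a * w + aeval v p * b, p * r, ?_⟩
    rw [add_mul, mul_assoc, hw, map_mul]
    noncomm_ring

theorem exists_eq_mul_of_mul_eq_mul (u v y : A) (hgen : Algebra.adjoin k {u, v} = ⊤)
    (hu : ∀ z, ∃ w, u * z = w * u) (π : A →ₐ[k] k[X]) (hπu : π u = 0) (hπv : π v = X)
    (hπy : π y = X) (f b : A) (h : f * y = b * u) : ∃ p, f = p * u := by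
  obtain ⟨a, p, rfl⟩ := exists_eq_mul_add_aeval u v hgen hu f
  have h1 := congrArg π h
  have h2 : π (aeval v p) = p := by
    rw [← Polynomial.aeval_algHom_apply, hπv, aeval_X_left_apply]
  simp only [map_mul, map_add, hπu, hπy, h2, mul_zero, zero_add] at h1
  have h3 : p = 0 := by simpa using h1
  exact ⟨a, by simp [h3]⟩

end Regularity

section Planes

open Polynomial

variable {k : Type} [Field k]

theorem adjoin_mkAlgHom_eq_top (r : FreeAlgebra k (Fin 2) → FreeAlgebra k (Fin 2) → Prop) :
    Algebra.adjoin k {RingQuot.mkAlgHom k r (FreeAlgebra.ι k 0),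
      RingQuot.mkAlgHom k r (FreeAlgebra.ι k 1)} = ⊤ := by
  rw [← (AlgHom.range_eq_top _).2 (RingQuot.mkAlgHom_surjective k r), ← Algebra.map_top,
    ← FreeAlgebra.adjoin_range_ι, AlgHom.map_adjoin, ← Set.range_comp]
  congr 1
  ext x
  simp [Fin.exists_fin_two, eq_comm]

theorem adjoin_qU_qV (q : k) : Algebra.adjoin k {qU k q, qV k q} = ⊤ :=
  adjoin_mkAlgHom_eq_top _

theorem adjoin_jU_jV : Algebra.adjoin k {jU k, jV k} = ⊤ :=
  adjoin_mkAlgHom_eq_top _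

theorem qV_mul_qU (q : k) : qV k q * qU k q = q • (qU k q * qV k q) := by
  simpa [qU, qV] using RingQuot.mkAlgHom_rel k (QuantumRel.rel (K := k) (q := q))

theorem jV_mul_jU : jV k * jU k = jU k * jV k + jU k * jU k := by
  simpa [jU, jV] using RingQuot.mkAlgHom_rel k (JordanRel.rel (K := k))

theorem exists_quantumPlane_lift {B : Type*} [Semiring B] [Algebra k B] (q : k) (x y : B)
    (h : y * x = q • (x * y)) :
    ∃ f : QuantumPlane k q →ₐ[k] B, f (qU k q) = x ∧ f (qV k q) = y := by
  refine ⟨RingQuot.liftAlgHom k ⟨FreeAlgebra.lift k ![x, y], ?_⟩, ?_, ?_⟩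
  · rintro _ _ ⟨⟩
    simpa using h
  · simp [qU]
  · simp [qV]

theorem exists_jordanPlane_lift {B : Type*} [Semiring B] [Algebra k B] (x y : B)
    (h : y * x = x * y + x * x) :
    ∃ f : JordanPlane k →ₐ[k] B, f (jU k) = x ∧ f (jV k) = y := by
  refine ⟨RingQuot.liftAlgHom k ⟨FreeAlgebra.lift k ![x, y], ?_⟩, ?_, ?_⟩
  · rintro _ _ ⟨⟩
    simpa using h
  · simp [jU]
  · simp [jV]

theorem qU_mul_eq_zero (q : k) (a : QuantumPlane k q) (ha : qU k q * a = 0) : a = 0 := by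
  let τ : k[X] →ₗ[k] k[X] := (aeval (q • (X : k[X]))).toLinearMap
  obtain ⟨ρ, hu, hv⟩ := exists_quantumPlane_lift q (coeffMulX k) (oreMulLeft τ 0) (by
    refine Finsupp.lhom_ext fun i p => ?_
    simp [-Finsupp.single_mul, oreMulLeft_single, coeffMulX_single, τ])
  refine eq_zero_of_mul_left_eq_zero _ _ (adjoin_qU_qV q) τ 0 (fun p => ?_) ρ hu hv a ha
  induction p using Polynomial.induction_on' with
  | add p r hp hr => simp [mul_add, add_mul, hp, hr]
  | monomial n c =>
    suffices h : qV k q * qU k q ^ n = q ^ n • (qU k q ^ n * qV k q) by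
      simp [τ, aeval_monomial, _root_.smul_pow, ← Algebra.smul_def, h, smul_comm c]
    induction n with
    | zero => simp
    | succ n ih =>
      rw [pow_succ, ← mul_assoc, ih, smul_mul_assoc, mul_assoc, qV_mul_qU, mul_smul_comm,
        smul_smul, ← pow_succ, mul_assoc]

theorem jU_mul_eq_zero (a : JordanPlane k) (ha : jU k * a = 0) : a = 0 := by
  let δ : k[X] →ₗ[k] k[X] := LinearMap.mulLeft k (X ^ 2) ∘ₗ derivative
  obtain ⟨ρ, hu, hv⟩ := exists_jordanPlane_lift (k := k) (coeffMulX k) (oreMulLeft .id δ) (by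
    refine Finsupp.lhom_ext fun i p => ?_
    have : δ (X * p) = X * δ p + X * (X * p) := by
      simp [δ]
      ring
    simp [-Finsupp.single_mul, oreMulLeft_single, coeffMulX_single, this, add_assoc])
  refine eq_zero_of_mul_left_eq_zero _ _ adjoin_jU_jV .id δ (fun p => ?_) ρ hu hv a ha
  induction p using Polynomial.induction_on with
  | C a => simp [δ, Algebra.commutes]
  | add p r hp hr =>
    simp only [map_add, mul_add, add_mul, hp, hr]
    abel
  | monomial n c ih =>
    have hδ : ∀ p : k[X], δ (p * X) = δ p * X + p * X * X := fun p => by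
      simp [δ]
      ring
    rw [pow_succ, ← mul_assoc, hδ]
    simp only [LinearMap.id_apply] at ih ⊢
    rw [map_mul _ _ X, map_add, map_mul _ _ X, map_mul _ _ X, map_mul _ _ X, aeval_X, ← mul_assoc,
      ih, add_mul, mul_assoc _ (jV k), jV_mul_jU]
    noncomm_ring

theorem quantumPlane_normal (q : k) (hq : q ≠ 0) :
    (∀ z, ∃ w, z * qU k q = qU k q * w) ∧ (∀ z, ∃ w, qU k q * z = w * qU k q) ∧
      ∀ c, c * qU k q = 0 → c = 0 := by
  obtain ⟨σ, hσu, hσv⟩ := exists_quantumPlane_lift q (qU k q) (q • qV k q) (by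
    rw [smul_mul_assoc, qV_mul_qU, mul_smul_comm])
  obtain ⟨τ, hτu, hτv⟩ := exists_quantumPlane_lift q (qU k q) (q⁻¹ • qV k q) (by
    rw [smul_mul_assoc, qV_mul_qU, mul_smul_comm, smul_comm])
  obtain ⟨h1, h2, h3⟩ := eq_zero_of_mul_right_eq_zero (qU k q) (qV k q) (adjoin_qU_qV q)
    (qU_mul_eq_zero q) σ τ (by rw [hσu]) (by rw [hσv, qV_mul_qU, mul_smul_comm])
    (by rw [hσu, hτu]) (by rw [hσv, map_smul, hτv, smul_inv_smul₀ hq])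
    (by rw [hτu, hσu]) (by rw [hτv, map_smul, hσv, inv_smul_smul₀ hq])
  exact ⟨fun z => ⟨_, h1 z⟩, fun z => ⟨_, h2 z⟩, h3⟩

theorem quantumPlane_dvd (q : k) (hq : q ≠ 0) (f b : QuantumPlane k q)
    (h : f * qV k q = b * qU k q) : ∃ p, f = p * qU k q := by
  obtain ⟨π, hu, hv⟩ := exists_quantumPlane_lift q (0 : k[X]) X (by simp)
  exact exists_eq_mul_of_mul_eq_mul _ _ _ (adjoin_qU_qV q) (quantumPlane_normal q hq).2.1 π hu hv hv
    f b h

theorem jordanPlane_normal :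
    (∀ z, ∃ w, z * jU k = jU k * w) ∧ (∀ z, ∃ w, jU k * z = w * jU k) ∧
      ∀ c, c * jU k = 0 → c = 0 := by
  obtain ⟨σ, hσu, hσv⟩ := exists_jordanPlane_lift (k := k) (jU k) (jV k + jU k) (by
    rw [add_mul, jV_mul_jU, mul_add])
  obtain ⟨τ, hτu, hτv⟩ := exists_jordanPlane_lift (k := k) (jU k) (jV k - jU k) (by
    rw [sub_mul, jV_mul_jU, mul_sub]; abel)
  obtain ⟨h1, h2, h3⟩ := eq_zero_of_mul_right_eq_zero (jU k) (jV k) adjoin_jU_jV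
    jU_mul_eq_zero σ τ (by rw [hσu]) (by rw [hσv, jV_mul_jU, mul_add])
    (by rw [hσu, hτu]) (by rw [hσv, map_add, hτv, hτu, sub_add_cancel])
    (by rw [hτu, hσu]) (by rw [hτv, map_sub, hσv, hσu, add_sub_cancel_right])
  exact ⟨fun z => ⟨_, h1 z⟩, fun z => ⟨_, h2 z⟩, h3⟩

theorem jordanPlane_dvd (f b : JordanPlane k)
    (h : f * (jV k + jU k) = b * jU k) : ∃ p, f = p * jU k := by
  obtain ⟨π, hu, hv⟩ := exists_jordanPlane_lift (k := k) (0 : k[X]) X (by simp)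
  exact exists_eq_mul_of_mul_eq_mul _ _ _ adjoin_jU_jV jordanPlane_normal.2.1 π hu hv
    (by simp [hu, hv]) f b h

end Planes

section Cyclic

variable {k A G : Type*} [Field k] [Ring A] [Algebra k A] [Group G] [MulSemiringAction G A]

theorem pow_smul_eq_of_smul_eq [SMulCommClass G k A] {g : G} {ω : k} {w : A} (h : g • w = ω • w) (i : ℕ) :
    g ^ i • w = ω ^ i • w := by
  induction i with
  | zero => simp
  | succ i ih => rw [pow_succ, mul_smul, h, smul_comm, ih, smul_smul, ← pow_succ']

theorem smul_mem_pertinencyIdeal_of_field (c : k) {x : A} (hx : x ∈ pertinencyIdeal G A) :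
    c • x ∈ pertinencyIdeal G A := by
  simpa [Algebra.smul_def] using mul_mem_pertinencyIdeal (algebraMap k A c) hx

/-- The function `g ↦ ∑ⱼ wⁿ⁻¹⁻ʲ * (g • wʲ)`. -/
def geomTrace (G : Type*) [Group G] [MulSemiringAction G A] (n : ℕ) (w : A) : G → A :=
  fun g => ∑ j ∈ Finset.range n, w ^ (n - 1 - j) * g • w ^ j

theorem geomTrace_mem (n : ℕ) (w : A) : geomTrace G n w ∈ traceIdeal G A := by
  have : geomTrace G n w =
      ∑ j ∈ Finset.range n, fun g : G => w ^ (n - 1 - j) * g • w ^ j := by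
    ext g
    simp [geomTrace]
  rw [this]
  exact sum_mem fun j _ => mem_traceIdeal _ _

theorem geomTrace_apply_of_smul_eq (n : ℕ) (w : A) (g : G) (ζ : k) (hg : g • w = ζ • w) :
    geomTrace G n w g = (∑ j ∈ Finset.range n, ζ ^ j) • w ^ (n - 1) := by
  rw [geomTrace, Finset.sum_smul]
  refine Finset.sum_congr rfl fun j hj => ?_
  rw [smul_pow', hg, smul_pow, mul_smul_comm, ← pow_add]
  congr 2
  have := Finset.mem_range.1 hj
  omega

theorem geomTrace_one (n : ℕ) (w : A) : geomTrace G n w 1 = (n : k) • w ^ (n - 1) := by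
  simpa using geomTrace_apply_of_smul_eq n w (1 : G) (1 : k) (by simp)

theorem geomTrace_eq_zero [SMulCommClass G k A] {n : ℕ} {w : A} {g : G} {ω : k} (hω : IsPrimitiveRoot ω n)
    (hgn : orderOf g = n) (hg : g • w = ω • w) (i : ℕ) (hi : g ^ i ≠ 1) :
    geomTrace G n w (g ^ i) = 0 := by
  rw [geomTrace_apply_of_smul_eq n w (g ^ i) (ω ^ i) (pow_smul_eq_of_smul_eq hg i)]
  have h1 : ω ^ i ≠ 1 := fun h => hi (by
    rw [← orderOf_dvd_iff_pow_eq_one, hgn]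
    exact (hω.pow_eq_one_iff_dvd i).1 h)
  have h2 : (∑ j ∈ Finset.range n, (ω ^ i) ^ j) * (ω ^ i - 1) = 0 := by
    rw [geom_sum_mul, ← pow_mul, mul_comm, pow_mul, hω.pow_eq_one, one_pow, sub_self]
  rw [(mul_eq_zero.1 h2).resolve_right (sub_ne_zero.2 h1), zero_smul]

theorem pow_mem_pertinencyIdeal_of_cyclic [SMulCommClass G k A] [CharZero k] {n : ℕ} (hn : 0 < n) {w : A} {g : G} {ω : k}
    (hω : IsPrimitiveRoot ω n) (hgn : orderOf g = n) (hG : ∀ x : G, ∃ i : ℕ, x = g ^ i)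
    (hg : g • w = ω • w) : w ^ n ∈ pertinencyIdeal G A := by
  have h1 := mem_pertinencyIdeal_of_forall (geomTrace_mem (G := G) n w) (fun x hx => by
    obtain ⟨i, rfl⟩ := hG x
    exact geomTrace_eq_zero hω hgn hg i hx)
  rw [geomTrace_one (k := k)] at h1
  have h2 := mul_mem_pertinencyIdeal w (smul_mem_pertinencyIdeal_of_field (n : k)⁻¹ h1)
  rwa [inv_smul_smul₀ (Nat.cast_ne_zero.2 hn.ne'), ← pow_succ', Nat.sub_add_cancel hn] at h2

end Cyclic

section QuantumPlane

variable {k : Type} [Field k]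

theorem mul_pow_eq_zero {A : Type*} [Ring A] {u : A} (hu : ∀ c, c * u = 0 → c = 0) (n : ℕ) (c : A)
    (h : c * u ^ n = 0) : c = 0 := by
  induction n with
  | zero => simpa using h
  | succ n ih => exact ih (hu _ (by rwa [mul_assoc, ← pow_succ]))

theorem exists_mul_pow_eq {A : Type*} [Ring A] {u : A} (hu : ∀ z, ∃ w, z * u = u * w) (n : ℕ)
    (z : A) : ∃ w, z * u ^ n = u ^ n * w := by
  induction n with
  | zero => exact ⟨z, by simp⟩
  | succ n ih =>
    obtain ⟨w, hw⟩ := ih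
    obtain ⟨w', hw'⟩ := hu w
    exact ⟨w', by rw [pow_succ, ← mul_assoc, hw, mul_assoc, hw', mul_assoc]⟩

theorem qV_pow_mul_qU (q : k) (m : ℕ) :
    qV k q ^ m * qU k q = q ^ m • (qU k q * qV k q ^ m) := by
  induction m with
  | zero => simp
  | succ m ih =>
    rw [pow_succ, mul_assoc, qV_mul_qU, mul_smul_comm, ← mul_assoc, ih, smul_mul_assoc, smul_smul,
      ← pow_succ', mul_assoc]

theorem qV_pow_mul_qU_pow (q : k) (m n : ℕ) :
    qV k q ^ m * qU k q ^ n = q ^ (m * n) • (qU k q ^ n * qV k q ^ m) := by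
  induction n with
  | zero => simp
  | succ n ih =>
    rw [pow_succ, ← mul_assoc, ih, smul_mul_assoc, mul_assoc, qV_pow_mul_qU, mul_smul_comm,
      smul_smul, ← pow_add, ← mul_assoc, Nat.mul_succ]

theorem quantumPlane_dvd_pow (q : k) (hq : q ≠ 0) (m n : ℕ) (f b : QuantumPlane k q)
    (h : f * qV k q ^ m = b * qU k q ^ n) : ∃ p, f = p * qU k q ^ n := by
  have h1 : ∀ (m : ℕ) (f b : QuantumPlane k q), f * qV k q ^ m = b * qU k q →
      ∃ p, f = p * qU k q := by
    intro m
    induction m with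
    | zero => exact fun f b h => ⟨b, by simpa using h⟩
    | succ m ih =>
      intro f b h
      rw [pow_succ, ← mul_assoc] at h
      obtain ⟨p, hp⟩ := quantumPlane_dvd q hq _ _ h
      exact ih _ _ hp
  induction n generalizing f b with
  | zero => exact ⟨f, by simp⟩
  | succ n ih =>
    rw [pow_succ, ← mul_assoc] at h
    obtain ⟨p, rfl⟩ := h1 m f _ h
    have h2 : (p * qV k q ^ m - (q ^ m • b) * qU k q ^ n) * qU k q = 0 := by
      rw [sub_mul, mul_assoc p, qV_pow_mul_qU, mul_smul_comm, ← mul_assoc, h, smul_mul_assoc,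
        smul_mul_assoc, sub_self]
    obtain ⟨r, rfl⟩ := ih p _ (sub_eq_zero.1 ((quantumPlane_normal q hq).2.2 _ h2))
    exact ⟨r, by rw [mul_assoc, pow_succ]⟩

theorem auslander_quantumPlane (q : k) (hq : q ≠ 0) {G : Type*} [Group G] [Fintype G]
    [MulSemiringAction G (QuantumPlane k q)] (m : ℕ)
    (hu : qU k q ^ m ∈ pertinencyIdeal G (QuantumPlane k q))
    (hv : qV k q ^ m ∈ pertinencyIdeal G (QuantumPlane k q))
    (s w : QuantumPlane k q) (hs : ∀ g : G, g • s = s) (hsw : s = qU k q ^ m * w)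
    (hw : ∀ c, c * w = 0 → c = 0) :
    (∀ φ : QuantumPlane k q →+ QuantumPlane k q,
        (∀ x s : QuantumPlane k q, (∀ g : G, g • s = s) → φ (x * s) = φ x * s) →
        ∃ c : G → QuantumPlane k q, ∀ x : QuantumPlane k q, φ x = ∑ g : G, c g * (g • x)) ∧
      (∀ c : G → QuantumPlane k q, (∀ x : QuantumPlane k q, (∑ g : G, c g * (g • x)) = 0) →
        ∀ g : G, c g = 0) := by
  obtain ⟨hn, -, hr⟩ := quantumPlane_normal q hq
  have hv' : (q ^ (m * m))⁻¹ • qV k q ^ m ∈ pertinencyIdeal G (QuantumPlane k q) := by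
    simpa [Algebra.smul_def] using
      mul_mem_pertinencyIdeal (algebraMap k _ (q ^ (m * m))⁻¹) hv
  refine auslander_of_mem_pertinencyIdeal (qU k q ^ m) _ (qV k q ^ m) s hu hv' ?_
    (mul_pow_eq_zero hr m) (quantumPlane_dvd_pow q hq m m) hs ?_ ?_
  · rw [smul_mul_assoc, qV_pow_mul_qU_pow, inv_smul_smul₀ (pow_ne_zero _ hq)]
  · intro c hc
    rw [hsw, ← mul_assoc] at hc
    exact mul_pow_eq_zero hr m _ (hw _ hc)
  · intro z
    obtain ⟨w', h⟩ := exists_mul_pow_eq hn m z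
    exact ⟨w' * w, by rw [hsw, ← mul_assoc, h, mul_assoc]⟩

theorem auslander_quantumPlane_cyclic [CharZero k] {n : ℕ} (hn : 0 < n) {ω : k}
    (hω : IsPrimitiveRoot ω n) (q : k) (hq : q ≠ 0) {G : Type*} [Group G] [Fintype G] (g : G)
    (hgn : orderOf g = n) (hG : ∀ x : G, ∃ i : ℕ, x = g ^ i)
    [MulSemiringAction G (QuantumPlane k q)] [SMulCommClass G k (QuantumPlane k q)]
    (hu : g • qU k q = ω • qU k q) (hv : g • qV k q = ω⁻¹ • qV k q) :
    (∀ φ : QuantumPlane k q →+ QuantumPlane k q,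
        (∀ x s : QuantumPlane k q, (∀ g : G, g • s = s) → φ (x * s) = φ x * s) →
        ∃ c : G → QuantumPlane k q, ∀ x : QuantumPlane k q, φ x = ∑ g : G, c g * (g • x)) ∧
      (∀ c : G → QuantumPlane k q, (∀ x : QuantumPlane k q, (∑ g : G, c g * (g • x)) = 0) →
        ∀ g : G, c g = 0) := by
  refine auslander_quantumPlane q hq n (pow_mem_pertinencyIdeal_of_cyclic hn hω hgn hG hu)
    (pow_mem_pertinencyIdeal_of_cyclic hn hω.inv hgn hG hv) (qU k q ^ n) 1 ?_ (by simp) (by simp)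
  intro x
  obtain ⟨i, rfl⟩ := hG x
  rw [smul_pow', pow_smul_eq_of_smul_eq hu, smul_pow, ← pow_mul, mul_comm, pow_mul, hω.pow_eq_one,
    one_pow, one_smul]

end QuantumPlane

theorem auslander_jordanPlane {k : Type} [Field k] [CharZero k] {G : Type*} [Group G] [Fintype G]
    (h : G) (hG : ∀ x : G, x = 1 ∨ x = h)
    [MulSemiringAction G (JordanPlane k)] [SMulCommClass G k (JordanPlane k)]
    (hu : h • jU k = - jU k) (hv : h • jV k = - jV k) :
    (∀ φ : JordanPlane k →+ JordanPlane k,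
        (∀ x s : JordanPlane k, (∀ g : G, g • s = s) → φ (x * s) = φ x * s) →
        ∃ c : G → JordanPlane k, ∀ x : JordanPlane k, φ x = ∑ g : G, c g * (g • x)) ∧
      (∀ c : G → JordanPlane k, (∀ x : JordanPlane k, (∑ g : G, c g * (g • x)) = 0) →
        ∀ g : G, c g = 0) := by
  have key : ∀ w : JordanPlane k, h • w = -w → w ∈ pertinencyIdeal G (JordanPlane k) := by
    intro w hw
    have h1 := mem_pertinencyIdeal_of_forall (G := G)
      (add_mem (mem_traceIdeal w 1) (mem_traceIdeal 1 w)) (fun x hx => by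
        simp [(hG x).resolve_left hx, hw])
    have h2 := smul_mem_pertinencyIdeal_of_field (2 : k)⁻¹ h1
    simpa [← two_smul k w] using h2
  obtain ⟨hn, -, hr⟩ := jordanPlane_normal (k := k)
  refine auslander_of_mem_pertinencyIdeal (jU k) (jV k) (jV k + jU k) (jU k ^ 2) (key _ hu)
    (key _ hv) (by rw [jV_mul_jU, mul_add]) hr jordanPlane_dvd ?_ (mul_pow_eq_zero hr 2) ?_
  · intro x
    rcases hG x with rfl | rfl
    · simp
    · rw [smul_pow', hu]
      exact neg_sq (R := JordanPlane k) (jU k)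
  · intro z
    obtain ⟨w, hw⟩ := hn z
    obtain ⟨w', hw'⟩ := hn w
    exact ⟨jU k * w', by rw [sq, ← mul_assoc, hw, mul_assoc, hw']⟩

section Dihedral

variable {k A G : Type*} [Field k] [Ring A] [Algebra k A] [Group G] [MulSemiringAction G A]

theorem commute_pow_two_mul_of_anticommute {u v : A} (hvu : v * u = -(u * v)) (n : ℕ) :
    Commute (u ^ (2 * n)) v := by
  rw [pow_mul]
  refine Commute.pow_left ?_ n
  rw [commute_iff_eq, sq, ← mul_assoc v, hvu, neg_mul, mul_assoc u v, hvu, mul_neg, neg_neg,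
    mul_assoc]

theorem mul_mul_pow_mul_pow_of_anticommute {u v : A} (hvu : v * u = -(u * v)) (a b : ℕ) :
    u * v * (u ^ a * v ^ b) = (-1) ^ (a + b) * (u ^ a * v ^ b * (u * v)) := by
  have hu : SemiconjBy (u * v) u (-u) := by
    rw [SemiconjBy, mul_assoc, hvu, mul_neg, neg_mul]
  have hv : SemiconjBy (u * v) v (-v) := by
    rw [SemiconjBy, neg_mul, ← mul_assoc v, hvu, neg_mul, neg_neg]
  have h := (hu.pow_right a).mul_right (hv.pow_right b)
  rw [h.eq]
  rcases Nat.even_or_odd a with ha | ha <;> rcases Nat.even_or_odd b with hb | hb <;>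
    simp [ha.neg_pow, hb.neg_pow, pow_add]

theorem geomTrace_apply_of_swap (n : ℕ) {u v : A} {r : G} {ζ : k} (hru : r • u = ζ • v) :
    geomTrace G n u r = ∑ j ∈ Finset.range n, ζ ^ j • (u ^ (n - 1 - j) * v ^ j) := by
  refine Finset.sum_congr rfl fun j _ => ?_
  rw [smul_pow', hru, smul_pow, mul_smul_comm]

theorem mul_mul_geomTrace_of_swap (n : ℕ) {u v : A} (hvu : v * u = -(u * v)) {r : G} {ζ : k}
    (hru : r • u = ζ • v) :
    u * v * geomTrace G n u r = (-1) ^ (n - 1) * (geomTrace G n u r * (u * v)) := by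
  rw [geomTrace_apply_of_swap n hru, Finset.mul_sum, Finset.sum_mul, Finset.mul_sum]
  refine Finset.sum_congr rfl fun j hj => ?_
  have : n - 1 - j + j = n - 1 := by
    have := Finset.mem_range.1 hj
    omega
  rw [mul_smul_comm, mul_mul_pow_mul_pow_of_anticommute hvu, this, smul_mul_assoc, mul_smul_comm]

theorem commute_geomTrace_of_swap (n m : ℕ) {u v : A} (hvu : v * u = -(u * v)) {r : G} {ζ : k}
    (hru : r • u = ζ • v) : Commute (u ^ (2 * m)) (geomTrace G n u r) := by
  rw [geomTrace_apply_of_swap n hru]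
  refine Commute.sum_right _ _ _ fun j _ => Commute.smul_right ?_ _
  exact ((Commute.refl u).pow_pow _ _).mul_right
    ((commute_pow_two_mul_of_anticommute hvu m).pow_right j)

theorem pow_mem_pertinencyIdeal_of_dihedral [SMulCommClass G k A] [CharZero k] {n : ℕ} (hn : 0 < n)
    {u v : A} (hvu : v * u = -(u * v)) {g h : G} {ω : k} (hω : IsPrimitiveRoot ω n)
    (hgn : orderOf g = n) (hG : ∀ x : G, ∃ i : ℕ, x = g ^ i ∨ x = g ^ i * h)
    (hgu : g • u = ω • u) (hgv : g • v = ω⁻¹ • v) (hhu : h • u = v) (hhv : h • v = u) :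
    u ^ (3 * n) ∈ pertinencyIdeal G A := by
  have hn' : (n : k) ≠ 0 := Nat.cast_ne_zero.2 hn.ne'
  have hru : ∀ i : ℕ, (g ^ i * h) • u = ω⁻¹ ^ i • v := fun i => by
    rw [mul_smul, hhu, pow_smul_eq_of_smul_eq hgv]
  have hrv : ∀ i : ℕ, (g ^ i * h) • v = ω ^ i • u := fun i => by
    rw [mul_smul, hhv, pow_smul_eq_of_smul_eq hgu]
  have hT := geomTrace_mem (G := G) n u
  have h0 : ∀ i : ℕ, g ^ i ≠ 1 → geomTrace G n u (g ^ i) = 0 :=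
    geomTrace_eq_zero hω hgn hgu
  have h1 := mem_pertinencyIdeal_of_forall (add_mem (mul_mem_traceIdeal (u * v) 1 hT)
    (mul_mem_traceIdeal ((-1) ^ (n - 1)) (u * v) hT)) (fun x hx => by
      obtain ⟨i, rfl | rfl⟩ := hG x
      · simp [h0 i hx]
      · have : (g ^ i * h) • (u * v) = -(u * v) := by
          rw [smul_mul', hru, hrv, smul_mul_smul_comm, ← mul_pow,
            inv_mul_cancel₀ (hω.ne_zero hn.ne'), one_pow, one_smul, hvu]
        simp only [Pi.add_apply, smul_one, mul_one]
        rw [this, mul_mul_geomTrace_of_swap n hvu (hru i)]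
        simp [mul_assoc])
  have h2 := mem_pertinencyIdeal_of_forall (sub_mem (mul_mem_traceIdeal (u ^ (2 * n)) 1 hT)
    (mul_mem_traceIdeal 1 (v ^ (2 * n)) hT)) (fun x hx => by
      obtain ⟨i, rfl | rfl⟩ := hG x
      · simp [h0 i hx]
      · have : (g ^ i * h) • v ^ (2 * n) = u ^ (2 * n) := by
          rw [smul_pow', hrv, smul_pow, ← pow_mul, mul_comm i, mul_comm 2, mul_assoc, pow_mul,
            hω.pow_eq_one, one_pow, one_smul]
        simp only [Pi.sub_apply, smul_one, mul_one, one_mul]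
        rw [this, (commute_geomTrace_of_swap n n hvu (hru i)).eq, sub_self])
  simp only [Pi.add_apply, Pi.sub_apply, geomTrace_one (k := k), one_smul, mul_one, one_mul] at h1 h2
  have h3 : u ^ n * v ∈ pertinencyIdeal G A := by
    have e := mul_mul_pow_mul_pow_of_anticommute hvu (n - 1) 0
    simp only [pow_zero, mul_one, add_zero] at e
    rw [mul_smul_comm, mul_smul_comm, smul_mul_assoc,
      mul_assoc ((-1) ^ (n - 1)) _ (u * v), ← e, ← two_smul k,
      e] at h1
    have h4 := mul_mem_pertinencyIdeal ((-1) ^ (n - 1))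
      (smul_mem_pertinencyIdeal_of_field (n : k)⁻¹ (smul_mem_pertinencyIdeal_of_field (2 : k)⁻¹ h1))
    rwa [inv_smul_smul₀ two_ne_zero, inv_smul_smul₀ hn', ← mul_assoc, ← pow_add,
      Even.neg_one_pow ⟨_, rfl⟩, one_mul, ← mul_assoc, ← pow_succ, Nat.sub_add_cancel hn] at h4
  rw [mul_smul_comm, smul_mul_assoc, ← smul_sub] at h2
  have h4 := mul_mem_pertinencyIdeal u (smul_mem_pertinencyIdeal_of_field (n : k)⁻¹ h2)
  have h5 := mul_mul_mem_pertinencyIdeal 1 (v ^ (2 * n - 1)) h3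
  have h6 := add_mem h4 h5
  have e1 : u * (u ^ (2 * n) * u ^ (n - 1)) = u ^ (3 * n) := by
    rw [← pow_add, ← pow_succ']
    congr 1
    omega
  have e2 : u * (u ^ (n - 1) * v ^ (2 * n)) = u ^ n * v * v ^ (2 * n - 1) := by
    rw [← mul_assoc, ← pow_succ', mul_assoc, ← pow_succ', Nat.sub_add_cancel hn,
      Nat.sub_add_cancel (by omega)]
  rwa [inv_smul_smul₀ hn', mul_sub, e1, e2, one_mul, sub_add_cancel] at h6

theorem auslander_quantumPlane_dihedral {k : Type} [Field k] [CharZero k] {n : ℕ} (hn : 0 < n)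
    {ω : k} (hω : IsPrimitiveRoot ω n) {G : Type*} [Group G] [Fintype G] (g h : G)
    (hgn : orderOf g = n) (hG : ∀ x : G, ∃ i : ℕ, x = g ^ i ∨ x = g ^ i * h)
    [MulSemiringAction G (QuantumPlane k (-1 : k))] [SMulCommClass G k (QuantumPlane k (-1 : k))]
    (hgu : g • qU k (-1 : k) = ω • qU k (-1 : k)) (hgv : g • qV k (-1 : k) = ω⁻¹ • qV k (-1 : k))
    (hhu : h • qU k (-1 : k) = qV k (-1 : k)) (hhv : h • qV k (-1 : k) = qU k (-1 : k)) :
    (∀ φ : QuantumPlane k (-1 : k) →+ QuantumPlane k (-1 : k),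
        (∀ x s : QuantumPlane k (-1 : k), (∀ g : G, g • s = s) → φ (x * s) = φ x * s) →
        ∃ c : G → QuantumPlane k (-1 : k), ∀ x : QuantumPlane k (-1 : k),
          φ x = ∑ g : G, c g * (g • x)) ∧
      (∀ c : G → QuantumPlane k (-1 : k),
        (∀ x : QuantumPlane k (-1 : k), (∑ g : G, c g * (g • x)) = 0) → ∀ g : G, c g = 0) := by
  have hq : (-1 : k) ≠ 0 := by simp
  have hvu : qV k (-1 : k) * qU k (-1 : k) = -(qU k (-1 : k) * qV k (-1 : k)) := by
    rw [qV_mul_qU]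
    exact neg_one_smul k (qU k (-1 : k) * qV k (-1 : k))
  have hu0 := pow_mem_pertinencyIdeal_of_dihedral hn hvu hω hgn hG hgu hgv hhu hhv
  have hu : qU k (-1 : k) ^ (2 * (3 * n)) ∈ pertinencyIdeal G (QuantumPlane k (-1 : k)) := by
    rw [two_mul, pow_add]
    exact mul_mem_pertinencyIdeal _ hu0
  have hv : qV k (-1 : k) ^ (2 * (3 * n)) ∈ pertinencyIdeal G (QuantumPlane k (-1 : k)) := by
    have := smul_mem_pertinencyIdeal h hu
    rwa [smul_pow', hhu] at this
  have hcomm : Commute (qU k (-1 : k) ^ (2 * (3 * n))) (qV k (-1 : k) ^ (2 * (3 * n))) :=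
    (commute_pow_two_mul_of_anticommute hvu _).pow_right _
  have hωn : ω ^ (2 * (3 * n)) = 1 := by
    rw [← mul_assoc, mul_comm, pow_mul, hω.pow_eq_one, one_pow]
  have hgs : ∀ i : ℕ, g ^ i • (qU k (-1 : k) ^ (2 * (3 * n)) * qV k (-1 : k) ^ (2 * (3 * n))) =
      qU k (-1 : k) ^ (2 * (3 * n)) * qV k (-1 : k) ^ (2 * (3 * n)) := fun i => by
    rw [smul_mul', smul_pow', smul_pow', pow_smul_eq_of_smul_eq hgu, pow_smul_eq_of_smul_eq hgv,
      smul_pow, smul_pow, pow_right_comm, hωn, pow_right_comm, inv_pow, hωn, inv_one, one_pow,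
      one_smul, one_smul]
  refine auslander_quantumPlane (-1) hq _ hu hv
    (qU k (-1 : k) ^ (2 * (3 * n)) * qV k (-1 : k) ^ (2 * (3 * n))) _ (fun x => ?_) rfl
    (mul_pow_eq_zero (fun c hc => ?_) _)
  · obtain ⟨i, rfl | rfl⟩ := hG x
    · exact hgs i
    · rw [mul_smul, smul_mul' h, smul_pow', smul_pow', hhu, hhv, ← hcomm.eq, hgs]
  · refine (smul_eq_zero_iff_eq h).1 ((quantumPlane_normal (-1 : k) hq).2.2 _ ?_)
    rw [← hhv, ← smul_mul', hc, smul_zero]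

end Dihedral

/-- Auslander's theorem for quantum Kleinian singularities: the canonical map
`A # G → End_{A^G}(A)` is an isomorphism; equivalently, every right-`A^G`-linear additive
endomorphism of `A` is uniquely of the form `x ↦ ∑_g c_g · (g • x)`. -/
theorem auslander_quantumKleinian
    (k : Type) [Field k] [IsAlgClosed k] [CharZero k] :
    (∀ (n : ℕ), 0 < n → ∀ ω : k, IsPrimitiveRoot ω n → ∀ q : k, q ≠ 0 →
      ∀ (G : Type) [Group G] [Fintype G], ∀ g : G,
        orderOf g = n → (∀ x : G, ∃ i : ℕ, x = g ^ i) →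
      ∀ [MulSemiringAction G (QuantumPlane k q)] [SMulCommClass G k (QuantumPlane k q)],
        g • qU k q = ω • qU k q → g • qV k q = ω⁻¹ • qV k q →
      ((∀ φ : (QuantumPlane k q) →+ (QuantumPlane k q),
          (∀ (x s : (QuantumPlane k q)), (∀ gg : G, gg • s = s) → φ (x * s) = φ x * s) →
          ∃ c : G → (QuantumPlane k q), ∀ x : (QuantumPlane k q), φ x = ∑ gg : G, c gg * (gg • x)) ∧
        (∀ c : G → (QuantumPlane k q), (∀ x : (QuantumPlane k q), (∑ gg : G, c gg * (gg • x)) = 0) →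
          ∀ gg : G, c gg = 0))) ∧
    (∀ (G : Type) [Group G] [Fintype G], ∀ h : G,
        orderOf h = 2 → (∀ x : G, x = 1 ∨ x = h) →
      ∀ [MulSemiringAction G (QuantumPlane k (-1 : k))] [SMulCommClass G k (QuantumPlane k (-1 : k))],
        h • qU k (-1 : k) = qV k (-1 : k) → h • qV k (-1 : k) = qU k (-1 : k) →
      ((∀ φ : (QuantumPlane k (-1 : k)) →+ (QuantumPlane k (-1 : k)),
          (∀ (x s : (QuantumPlane k (-1 : k))), (∀ gg : G, gg • s = s) → φ (x * s) = φ x * s) →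
          ∃ c : G → (QuantumPlane k (-1 : k)), ∀ x : (QuantumPlane k (-1 : k)), φ x = ∑ gg : G, c gg * (gg • x)) ∧
        (∀ c : G → (QuantumPlane k (-1 : k)), (∀ x : (QuantumPlane k (-1 : k)), (∑ gg : G, c gg * (gg • x)) = 0) →
          ∀ gg : G, c gg = 0))) ∧
    (∀ (n : ℕ), 0 < n → ∀ ω : k, IsPrimitiveRoot ω n →
      ∀ (G : Type) [Group G] [Fintype G], ∀ g h : G,
        orderOf g = n → orderOf h = 2 → h * g * h = g⁻¹ →
        Fintype.card G = 2 * n →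
        (∀ x : G, ∃ i : ℕ, x = g ^ i ∨ x = g ^ i * h) →
      ∀ [MulSemiringAction G (QuantumPlane k (-1 : k))] [SMulCommClass G k (QuantumPlane k (-1 : k))],
        g • qU k (-1 : k) = ω • qU k (-1 : k) →
        g • qV k (-1 : k) = ω⁻¹ • qV k (-1 : k) →
        h • qU k (-1 : k) = qV k (-1 : k) → h • qV k (-1 : k) = qU k (-1 : k) →
      ((∀ φ : (QuantumPlane k (-1 : k)) →+ (QuantumPlane k (-1 : k)),
          (∀ (x s : (QuantumPlane k (-1 : k))), (∀ gg : G, gg • s = s) → φ (x * s) = φ x * s) →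
          ∃ c : G → (QuantumPlane k (-1 : k)), ∀ x : (QuantumPlane k (-1 : k)), φ x = ∑ gg : G, c gg * (gg • x)) ∧
        (∀ c : G → (QuantumPlane k (-1 : k)), (∀ x : (QuantumPlane k (-1 : k)), (∑ gg : G, c gg * (gg • x)) = 0) →
          ∀ gg : G, c gg = 0))) ∧
    (∀ (G : Type) [Group G] [Fintype G], ∀ h : G,
        orderOf h = 2 → (∀ x : G, x = 1 ∨ x = h) →
      ∀ [MulSemiringAction G (JordanPlane k)] [SMulCommClass G k (JordanPlane k)],
        h • jU k = - jU k → h • jV k = - jV k →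
      ((∀ φ : (JordanPlane k) →+ (JordanPlane k),
          (∀ (x s : (JordanPlane k)), (∀ gg : G, gg • s = s) → φ (x * s) = φ x * s) →
          ∃ c : G → (JordanPlane k), ∀ x : (JordanPlane k), φ x = ∑ gg : G, c gg * (gg • x)) ∧
        (∀ c : G → (JordanPlane k), (∀ x : (JordanPlane k), (∑ gg : G, c gg * (gg • x)) = 0) →
          ∀ gg : G, c gg = 0))) := by
  refine ⟨?_, ?_, ?_, ?_⟩
  · intro n hn ω hω q hq G _ _ g hgn hG _ _ hu hv
    exact auslander_quantumPlane_cyclic hn hω q hq g hgn hG hu hv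
  · intro G _ _ h _ hG _ _ hu hv
    exact auslander_quantumPlane_dihedral one_pos IsPrimitiveRoot.one 1 h orderOf_one
      (fun x => ⟨0, by simpa using hG x⟩) (by simp) (by simp) hu hv
  · intro n hn ω hω G _ _ g h hgn _ _ _ hG _ _ hgu hgv hhu hhv
    exact auslander_quantumPlane_dihedral hn hω g h hgn hG hgu hgv hhu hhv
  · intro G _ _ h _ hG _ _ hu hv
    exact auslander_jordanPlane h hG hu hv
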